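/- The slope map preserves the natural partial orderings: for every J ⊆ I and all μ̌, ν̌ ∈ Λ̌_J, if there exist lifts λ̌_μ, λ̌_ν ∈ Λ̌ of μ̌, ν̌ respectively with λ̌_ν − λ̌_μ ∈ K, then φ_J(ν̌) − φ_J(μ̌) ∈ K. -/

import Mathlib

/-- A vector on which a positive definite form with nonpositive off-diagonal entries takes
nonnegative values at all basis vectors indexing negative coordinates is nonnegative. -/
theorem nonneg_of_posDef_of_offDiag_nonpos {I : Type*} [Fintype I] (B : I → I → ℚ)
    (hoff : ∀ i j, i ≠ j → B i j ≤ 0)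
    (hpos : ∀ x : I → ℚ, x ≠ 0 → 0 < ∑ i, ∑ j, x i * B i j * x j)
    (y : I → ℚ) (hy : ∀ j, y j < 0 → 0 ≤ ∑ i, y i * B i j) (i : I) : 0 ≤ y i := by
  by_contra! hi
  let x : I → ℚ := fun j => max (-y j) 0
  have hx : x ≠ 0 := fun h => by
    have h' : max (-y i) 0 = 0 := congrFun h i
    linarith [le_max_left (-y i) 0]
  have hterm : ∀ i j, x i * B i j * x j ≤ -(y i * B i j * x j) := fun i j => by
    have hxj : 0 ≤ x j := le_max_right _ _
    have hsum : 0 ≤ x i + y i := by linarith [show -y i ≤ x i from le_max_left _ _]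
    suffices (x i + y i) * x j * B i j ≤ 0 by linarith
    rcases eq_or_ne i j with rfl | hij
    · have : (x i + y i) * x i = 0 := by
        rcases le_total 0 (y i) with h | h
        · simp [show x i = 0 from max_eq_right (by linarith)]
        · simp [show x i = -y i from max_eq_left (by linarith)]
      simp [this]
    · exact mul_nonpos_of_nonneg_of_nonpos (mul_nonneg hsum hxj) (hoff i j hij)
  have hcol : ∀ j, 0 ≤ (∑ i, y i * B i j) * x j := fun j => by
    rcases lt_or_ge (y j) 0 with h | h
    · exact mul_nonneg (hy j h) (le_max_right _ _)
    · simp [show x j = 0 from max_eq_right (by linarith)]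
  have hle : ∑ i, ∑ j, x i * B i j * x j ≤ -∑ j, (∑ i, y i * B i j) * x j := by
    calc ∑ i, ∑ j, x i * B i j * x j
        ≤ ∑ i, ∑ j, -(y i * B i j * x j) :=
          Finset.sum_le_sum fun i _ => Finset.sum_le_sum fun j _ => hterm i j
      _ = -∑ j, (∑ i, y i * B i j) * x j := by
          rw [Finset.sum_comm]
          simp only [Finset.sum_neg_distrib, Finset.sum_mul]
  linarith [hpos x hx, Finset.sum_nonneg fun j (_ : j ∈ Finset.univ) => hcol j]

/-- An element of the span of a subfamily indexed by `J` is a combination of the whole family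
with coefficients vanishing outside `J`. -/
theorem exists_sum_smul_of_mem_span_image {I V : Type*} [Fintype I] [AddCommGroup V] [Module ℚ V]
    (b : I → V) (J : Finset I) {v : V} (hv : v ∈ Submodule.span ℚ (b '' (J : Set I))) :
    ∃ s : I → ℚ, (∀ i ∉ J, s i = 0) ∧ v = ∑ i, s i • b i := by
  obtain ⟨l, hl, rfl⟩ := (Finsupp.mem_span_image_iff_linearCombination ℚ).1 hv
  refine ⟨l, fun i hi => ?_, ?_⟩
  · exact (Finsupp.mem_supported' ℚ l).1 hl i (by simpa using hi)
  · rw [Finsupp.linearCombination_apply, Finsupp.sum_fintype _ _ (by simp)]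


/-- the slope map preserves the natural partial orderings: if
`λ̌_ν − λ̌_μ` lies in the cone `K` of nonnegative rational combinations of the simple
coroots, then so does `φ_J(ν̌) − φ_J(μ̌)`. -/
theorem slope_preserves_order
    -- `Λ̌`, a finitely generated free `ℤ`-module
    (Λ : Type*) [AddCommGroup Λ] [Module ℤ Λ] [Module.Free ℤ Λ] [Module.Finite ℤ Λ]
    -- `Λ̌_ℚ = Λ̌ ⊗ ℚ`, realized as a `ℚ`-vector space containing `Λ̌` via `ι` and spanned by it
    (V : Type*) [AddCommGroup V] [Module ℚ V]
    (ι : Λ →ₗ[ℤ] V) (hι : Function.Injective ι)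
    (hspan : Submodule.span ℚ (Set.range ι) = ⊤)
    -- the finite index set, the simple coroots and the simple roots
    (I : Type*) [Fintype I] [DecidableEq I]
    (a : I → Λ)
    (ha : LinearIndependent ℚ (fun i => ι (a i)))
    (α : I → (Λ →ₗ[ℤ] ℤ))
    -- the `ℚ`-linear extensions of the simple roots to `Λ̌_ℚ`
    (αQ : I → (V →ₗ[ℚ] ℚ))
    (hαQ : ∀ i x, αQ i (ι x) = (α i x : ℚ))
    -- Cartan matrix axioms: `α_i(ǎ_i) = 2`, off-diagonal entries `≤ 0` and symmetrically zero
    (hdiag : ∀ i, α i (a i) = 2)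
    (hoff : ∀ i j, i ≠ j → α j (a i) ≤ 0)
    (hsymm0 : ∀ i j, i ≠ j → (α j (a i) = 0 ↔ α i (a j) = 0))
    -- finite type: there is a positive diagonal matrix `D` with `D·C` symmetric positive definite
    (d : I → ℚ) (hd : ∀ i, 0 < d i)
    (hDCsymm : ∀ i j, d i * (α j (a i) : ℚ) = d j * (α i (a j) : ℚ))
    (hDCpos : ∀ x : I → ℚ, x ≠ 0 →
      0 < ∑ i, ∑ j, x i * (d i * (α j (a i) : ℚ)) * x j)
    -- the slope maps `φ_J : Λ̌_J → Λ̌_ℚ`, with their defining property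
    (φ : ∀ J : Finset I, (Λ ⧸ Submodule.span ℤ (a '' (J : Set I))) → V)
    (hφ : ∀ (J : Finset I) (lam : Λ),
      (∀ j ∈ J, αQ j (φ J (Submodule.Quotient.mk lam)) = 0) ∧
      φ J (Submodule.Quotient.mk lam) - ι lam ∈
        Submodule.span ℚ ((fun i => ι (a i)) '' (J : Set I)))
    -- the cone `K` of nonnegative rational combinations of the simple coroots
    (K : Set V)
    (hK : ∀ v, v ∈ K ↔ ∃ r : I → ℚ, (∀ i, 0 ≤ r i) ∧ v = ∑ i, r i • ι (a i)) :
    ∀ (J : Finset I) (μ ν : Λ ⧸ Submodule.span ℤ (a '' (J : Set I))) (lamμ lamν : Λ),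
      Submodule.Quotient.mk lamμ = μ → Submodule.Quotient.mk lamν = ν →
      ι lamν - ι lamμ ∈ K → φ J ν - φ J μ ∈ K := by
  rintro J _ _ lamμ lamν rfl rfl hcone
  obtain ⟨r, hr, hrsum⟩ := (hK _).1 hcone
  obtain ⟨hμ0, hμ⟩ := hφ J lamμ
  obtain ⟨hν0, hν⟩ := hφ J lamν
  obtain ⟨s, hs, hssum⟩ := exists_sum_smul_of_mem_span_image _ J (Submodule.sub_mem _ hν hμ)
  have hw : φ J (Submodule.Quotient.mk lamν) - φ J (Submodule.Quotient.mk lamμ) =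
      ∑ i, (r i + s i) • ι (a i) := by
    simp only [add_smul, Finset.sum_add_distrib]
    rw [← hrsum, ← hssum]
    abel
  refine (hK _).2 ⟨fun i => r i + s i, fun i => ?_, hw⟩
  have hy := nonneg_of_posDef_of_offDiag_nonpos (fun i j => d i * (α j (a i) : ℚ))
    (fun i j hij => mul_nonpos_of_nonneg_of_nonpos (hd i).le (by exact_mod_cast hoff i j hij))
    hDCpos (fun i => (r i + s i) / d i) (fun j hj => ?_) i
  · simpa [(hd i).ne'] using mul_nonneg hy (hd i).le
  · have hjJ : j ∈ J := by
      by_contra h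
      have : 0 ≤ (r j + s j) / d j := div_nonneg (by simpa [hs j h] using hr j) (hd j).le
      exact absurd hj this.not_gt
    have h0 := congrArg (αQ j) hw
    simp only [map_sub, hν0 j hjJ, hμ0 j hjJ, sub_zero, map_sum, map_smul, hαQ,
      smul_eq_mul] at h0
    rw [h0]
    refine Finset.sum_le_sum fun k _ => le_of_eq ?_
    have := (hd k).ne'
    field_simp
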